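/- arXiv:2410.23146 — 2 statements merged into one kernel-verified Lean document; each statement's English description precedes it below -/
import Mathlib

section
/- Suppose we observe K distinct pairs of marginals (μ^(k),ν^(k)) ∈ Δ_N × Δ_M with cumulative sums A^(k)_i = Σ_{r=1}^i μ^(k)_r, B^(k)_j = Σ_{s=1}^j ν^(k)_s (A^(k)_0 = B^(k)_0 = 0), values α^(k) ∈ ℝ, and pairs (f^(k),g^(k)) ∈ ℝ^N × ℝ^M with ⟨f^(k),μ^(k)⟩ + ⟨g^(k),ν^(k)⟩ = α^(k). Assume that for every (i,j) ∈ {1,…,N}×{1,…,M} there exists k ∈ {1,…,K} such that max(A^(k)_{i−1}, B^(k)_{j−1}) < min(A^(k)_i, B^(k)_j). Then any two Monge matrices c, c' ∈ ℝ^{N×M} that are both consistent with these observations (i.e., (f^(k),g^(k)) ∈ Φ_c and OT_c(μ^(k),ν^(k)) = α^(k) for all k, and likewise for c') are equal; indeed c_{i,j} = f^(k)_i + g^(k)_j for any such k. -/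
open Finset

noncomputable section

/-- The set `Π(μ,ν)` of transport plans between `μ` and `ν`. -/
def Plans {N M : ℕ} (μ : Fin N → ℝ) (ν : Fin M → ℝ) : Set (Matrix (Fin N) (Fin M) ℝ) :=
  {π | (∀ i j, 0 ≤ π i j) ∧ (∀ i, ∑ j, π i j = μ i) ∧ (∀ j, ∑ i, π i j = ν j)}

/-- Frobenius inner product of two `N × M` real matrices. -/
def frob {N M : ℕ} (c π : Matrix (Fin N) (Fin M) ℝ) : ℝ := ∑ i, ∑ j, c i j * π i j

/-- The optimal transport cost `OT_c(μ,ν)`. -/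
def OTcost {N M : ℕ} (c : Matrix (Fin N) (Fin M) ℝ) (μ : Fin N → ℝ) (ν : Fin M → ℝ) : ℝ :=
  sInf (frob c '' Plans μ ν)

/-- The Monge property for a cost matrix. -/
def Monge {N M : ℕ} (c : Matrix (Fin N) (Fin M) ℝ) : Prop :=
  ∀ i r : Fin N, ∀ j s : Fin M, i < r → j < s → c i j + c r s ≤ c i s + c r j

/-- Cumulative sums: `cumsum μ i = Σ_{r < i} μ_r` (so `cumsum μ 0 = 0`). -/
def cumsum {N : ℕ} (μ : Fin N → ℝ) (i : ℕ) : ℝ :=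
  ∑ r ∈ Finset.univ.filter (fun r : Fin N => (r : ℕ) < i), μ r

lemma Plans.nonempty {N M : ℕ} {μ : Fin N → ℝ} {ν : Fin M → ℝ}
    (hμ : μ ∈ stdSimplex ℝ (Fin N)) (hν : ν ∈ stdSimplex ℝ (Fin M)) :
    (Plans μ ν).Nonempty := by
  refine ⟨fun i j => μ i * ν j, fun i j => mul_nonneg (hμ.1 i) (hν.1 j), fun i => ?_, fun j => ?_⟩
  · rw [← Finset.mul_sum, hν.2, mul_one]
  · rw [← Finset.sum_mul, hμ.2, one_mul]

lemma Plans.isCompact {N M : ℕ} (μ : Fin N → ℝ) (ν : Fin M → ℝ) : IsCompact (Plans μ ν) := by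
  have hsub : Plans μ ν ⊆
      Set.pi Set.univ fun i => Set.pi Set.univ fun _ : Fin M => Set.Icc 0 (μ i) := by
    intro π hπ i _ j _
    refine ⟨hπ.1 i j, ?_⟩
    rw [← hπ.2.1 i]
    exact Finset.single_le_sum (fun s _ => hπ.1 i s) (Finset.mem_univ j)
  refine IsCompact.of_isClosed_subset
    (isCompact_univ_pi fun i => isCompact_univ_pi fun _ => isCompact_Icc) ?_ hsub
  have hentry (i : Fin N) (j : Fin M) :
      Continuous fun π : Matrix (Fin N) (Fin M) ℝ => π i j :=
    continuous_id.matrix_elem i j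
  simp only [Plans, Set.ofPred_and, Set.ofPred_forall]
  refine IsClosed.inter ?_ (IsClosed.inter ?_ ?_)
  · exact isClosed_iInter fun i => isClosed_iInter fun j =>
      isClosed_le continuous_const (hentry i j)
  · exact isClosed_iInter fun i =>
      isClosed_eq (continuous_finsetSum _ fun j _ => hentry i j) continuous_const
  · exact isClosed_iInter fun j =>
      isClosed_eq (continuous_finsetSum _ fun i _ => hentry i j) continuous_const

lemma exists_optimal_plan {N M : ℕ} (c : Matrix (Fin N) (Fin M) ℝ)
    {μ : Fin N → ℝ} {ν : Fin M → ℝ}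
    (hμ : μ ∈ stdSimplex ℝ (Fin N)) (hν : ν ∈ stdSimplex ℝ (Fin M)) :
    ∃ π ∈ Plans μ ν, frob c π = OTcost c μ ν := by
  have hcont : Continuous (frob c) :=
    continuous_finsetSum _ fun i _ => continuous_finsetSum _ fun j _ =>
      continuous_const.mul (continuous_id.matrix_elem i j)
  exact ((Plans.isCompact μ ν).image hcont).sInf_mem ((Plans.nonempty hμ hν).image _)

/-- Complementary slackness. -/
lemma Plans.eq_add_of_pos {N M : ℕ} {c π : Matrix (Fin N) (Fin M) ℝ}
    {μ f : Fin N → ℝ} {ν g : Fin M → ℝ} (hπ : π ∈ Plans μ ν)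
    (hfg : ∀ i j, f i + g j ≤ c i j)
    (hopt : frob c π = (∑ i, f i * μ i) + ∑ j, g j * ν j)
    {i : Fin N} {j : Fin M} (hij : 0 < π i j) : c i j = f i + g j := by
  have hf : ∑ i, f i * μ i = ∑ i, ∑ j, f i * π i j := by
    simp only [← Finset.mul_sum, hπ.2.1]
  have hg : ∑ j, g j * ν j = ∑ i, ∑ j, g j * π i j := by
    rw [Finset.sum_comm]
    simp only [← Finset.mul_sum, hπ.2.2]
  have hnonneg (i : Fin N) (j : Fin M) : 0 ≤ (c i j - (f i + g j)) * π i j :=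
    mul_nonneg (sub_nonneg.2 (hfg i j)) (hπ.1 i j)
  have hzero : ∑ i, ∑ j, (c i j - (f i + g j)) * π i j = 0 := by
    simp only [sub_mul, add_mul, Finset.sum_sub_distrib, Finset.sum_add_distrib]
    rw [← hf, ← hg, ← hopt, frob, sub_self]
  have hrow := (Finset.sum_eq_zero_iff_of_nonneg
    fun i _ => Finset.sum_nonneg fun j _ => hnonneg i j).1 hzero i (Finset.mem_univ i)
  have hcell := (Finset.sum_eq_zero_iff_of_nonneg
    fun j _ => hnonneg i j).1 hrow j (Finset.mem_univ j)
  exact sub_eq_zero.1 ((mul_eq_zero.1 hcell).resolve_right hij.ne')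

lemma Plans.transpose_mem {N M : ℕ} {μ : Fin N → ℝ} {ν : Fin M → ℝ}
    {π : Matrix (Fin N) (Fin M) ℝ} (hπ : π ∈ Plans μ ν) : π.transpose ∈ Plans ν μ :=
  ⟨fun j i => hπ.1 i j, hπ.2.2, hπ.2.1⟩

/-- If the first `a` rows carry more mass than the first `b` columns, some of that mass lies
outside these columns. -/
lemma Plans.exists_pos_of_cumsum_lt {N M : ℕ} {μ : Fin N → ℝ} {ν : Fin M → ℝ}
    {π : Matrix (Fin N) (Fin M) ℝ} (hπ : π ∈ Plans μ ν) {a b : ℕ}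
    (hab : cumsum ν b < cumsum μ a) :
    ∃ (r : Fin N) (s : Fin M), (r : ℕ) < a ∧ b ≤ (s : ℕ) ∧ 0 < π r s := by
  by_contra! h
  refine hab.not_ge ?_
  calc cumsum μ a
      = ∑ r ∈ Finset.univ.filter (fun r : Fin N => (r : ℕ) < a),
          ∑ s ∈ Finset.univ.filter (fun s : Fin M => (s : ℕ) < b), π r s := by
        refine Finset.sum_congr rfl fun r hr => ?_
        rw [← hπ.2.1 r, Finset.sum_filter_of_ne]
        intro s _ hs
        by_contra! hbs
        exact hs (le_antisymm (h r s (Finset.mem_filter.1 hr).2 hbs) (hπ.1 r s))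
    _ ≤ ∑ r, ∑ s ∈ Finset.univ.filter (fun s : Fin M => (s : ℕ) < b), π r s :=
        Finset.sum_le_sum_of_subset_of_nonneg (Finset.filter_subset _ _)
          fun r _ _ => Finset.sum_nonneg fun s _ => hπ.1 r s
    _ = cumsum ν b :=
        Finset.sum_comm.trans (Finset.sum_congr rfl fun s _ => hπ.2.2 s)

lemma cumsum_succ {N : ℕ} (μ : Fin N → ℝ) (i : Fin N) :
    cumsum μ ((i : ℕ) + 1) = cumsum μ i + μ i := by
  have hset : (Finset.univ.filter fun r : Fin N => (r : ℕ) < (i : ℕ) + 1) =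
      insert i (Finset.univ.filter fun r : Fin N => (r : ℕ) < (i : ℕ)) := by
    ext r
    simp only [Finset.mem_filter, Finset.mem_univ, true_and, Finset.mem_insert, Fin.ext_iff]
    omega
  rw [cumsum, hset, Finset.sum_insert (by simp), add_comm, cumsum]

lemma Plans.exists_pos_of_cumsum_lt_succ {N M : ℕ} {μ : Fin N → ℝ} {ν : Fin M → ℝ}
    {π : Matrix (Fin N) (Fin M) ℝ} (hπ : π ∈ Plans μ ν) {i : Fin N}
    (hi : cumsum μ i < cumsum μ ((i : ℕ) + 1)) : ∃ s, 0 < π i s := by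
  rw [cumsum_succ, ← hπ.2.1 i] at hi
  by_contra! h
  linarith [Finset.sum_nonpos fun s (_ : s ∈ Finset.univ) => h s]

/-- For a Monge matrix dominating `f ⊕ g`, the contact set contains the main diagonal of every
rectangle whose antidiagonal it contains. -/
lemma Monge.eq_add_of_antidiagonal {N M : ℕ} {c : Matrix (Fin N) (Fin M) ℝ} (hc : Monge c)
    {f : Fin N → ℝ} {g : Fin M → ℝ} (hfg : ∀ i j, f i + g j ≤ c i j)
    {i r : Fin N} {j s : Fin M} (hir : i ≤ r) (hjs : j ≤ s)
    (h₁ : c i s = f i + g s) (h₂ : c r j = f r + g j) :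
    c i j = f i + g j ∧ c r s = f r + g s := by
  rcases hir.eq_or_lt with rfl | hir
  · exact ⟨h₂, h₁⟩
  rcases hjs.eq_or_lt with rfl | hjs
  · exact ⟨h₁, h₂⟩
  have := hc i r j s hir hjs
  constructor <;> linarith [hfg i j, hfg r s]

/-- A cell of the monotone plan belongs to the contact set of any optimal potentials. -/
lemma Monge.eq_add_of_overlap {N M : ℕ} {c : Matrix (Fin N) (Fin M) ℝ} (hc : Monge c)
    {μ f : Fin N → ℝ} {ν g : Fin M → ℝ}
    (hμ : μ ∈ stdSimplex ℝ (Fin N)) (hν : ν ∈ stdSimplex ℝ (Fin M))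
    (hfg : ∀ i j, f i + g j ≤ c i j)
    (hopt : OTcost c μ ν = (∑ i, f i * μ i) + ∑ j, g j * ν j) {i : Fin N} {j : Fin M}
    (hij : max (cumsum μ (i : ℕ)) (cumsum ν (j : ℕ)) <
      min (cumsum μ ((i : ℕ) + 1)) (cumsum ν ((j : ℕ) + 1))) :
    c i j = f i + g j := by
  obtain ⟨π, hπ, hπopt⟩ := exists_optimal_plan c hμ hν
  have hcontact {r : Fin N} {s : Fin M} : 0 < π r s → c r s = f r + g s :=
    Plans.eq_add_of_pos hπ hfg (hπopt.trans hopt)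
  obtain ⟨hi, hj⟩ := max_lt_iff.1 hij
  obtain ⟨hii, hij⟩ := lt_min_iff.1 hi
  obtain ⟨hji, hjj⟩ := lt_min_iff.1 hj
  obtain ⟨t, ht⟩ := Plans.exists_pos_of_cumsum_lt_succ hπ hii
  obtain ⟨u, hu⟩ := Plans.exists_pos_of_cumsum_lt_succ (Plans.transpose_mem hπ) hjj
  obtain ⟨p, q, hp, hq, hpq⟩ := Plans.exists_pos_of_cumsum_lt hπ hji
  obtain ⟨s, r, hs, hr, hrs⟩ := Plans.exists_pos_of_cumsum_lt (Plans.transpose_mem hπ) hij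
  replace ht := hcontact ht
  replace hu := hcontact hu
  replace hpq := hcontact hpq
  replace hrs := hcontact hrs
  replace hp : p ≤ i := Nat.lt_succ_iff.1 hp
  replace hs : s ≤ j := Nat.lt_succ_iff.1 hs
  replace hq : j ≤ q := hq
  replace hr : i ≤ r := hr
  rcases le_total j t with hjt | htj <;> rcases le_total i u with hiu | hui
  · exact (hc.eq_add_of_antidiagonal hfg hiu hjt ht hu).1
  · have his := (hc.eq_add_of_antidiagonal hfg hr (hs.trans hjt) ht hrs).1
    exact (hc.eq_add_of_antidiagonal hfg hui hs hu his).2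
  · have hpj := (hc.eq_add_of_antidiagonal hfg (hp.trans hiu) hq hpq hu).1
    exact (hc.eq_add_of_antidiagonal hfg hp htj hpj ht).2
  · exact (hc.eq_add_of_antidiagonal hfg hui htj hu ht).2

/-- Sufficient condition for identifiability of Monge cost matrices from total costs and
optimal potentials: if every cell `(i,j)` is "hit" by the monotone plan of some pair of
marginals, then consistent Monge matrices are unique, and are given by `f^(k) ⊕ g^(k)`. -/
theorem stmt7 (N M K : ℕ) (hN : 1 ≤ N) (hM : 1 ≤ M)
    (μ : Fin K → Fin N → ℝ) (ν : Fin K → Fin M → ℝ)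
    (hμ : ∀ k, μ k ∈ stdSimplex ℝ (Fin N)) (hν : ∀ k, ν k ∈ stdSimplex ℝ (Fin M))
    (hdist : Function.Injective (fun k => (μ k, ν k)))
    (α : Fin K → ℝ) (f : Fin K → Fin N → ℝ) (g : Fin K → Fin M → ℝ)
    (hα : ∀ k, (∑ i, f k i * μ k i) + (∑ j, g k j * ν k j) = α k)
    (hcover : ∀ (i : Fin N) (j : Fin M), ∃ k : Fin K,
      max (cumsum (μ k) (i : ℕ)) (cumsum (ν k) (j : ℕ)) <
        min (cumsum (μ k) ((i : ℕ) + 1)) (cumsum (ν k) ((j : ℕ) + 1)))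
    (c c' : Matrix (Fin N) (Fin M) ℝ) (hc : Monge c) (hc' : Monge c')
    (hcons : ∀ k, (∀ i j, f k i + g k j ≤ c i j) ∧ OTcost c (μ k) (ν k) = α k)
    (hcons' : ∀ k, (∀ i j, f k i + g k j ≤ c' i j) ∧ OTcost c' (μ k) (ν k) = α k) :
    c = c' ∧ ∀ (i : Fin N) (j : Fin M) (k : Fin K),
      max (cumsum (μ k) (i : ℕ)) (cumsum (ν k) (j : ℕ)) <
        min (cumsum (μ k) ((i : ℕ) + 1)) (cumsum (ν k) ((j : ℕ) + 1)) →
      c i j = f k i + g k j := by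
  have key (d : Matrix (Fin N) (Fin M) ℝ) (hd : Monge d)
      (hdcons : ∀ k, (∀ i j, f k i + g k j ≤ d i j) ∧ OTcost d (μ k) (ν k) = α k)
      (i : Fin N) (j : Fin M) (k : Fin K)
      (hk : max (cumsum (μ k) (i : ℕ)) (cumsum (ν k) (j : ℕ)) <
        min (cumsum (μ k) ((i : ℕ) + 1)) (cumsum (ν k) ((j : ℕ) + 1))) :
      d i j = f k i + g k j :=
    hd.eq_add_of_overlap (hμ k) (hν k) (hdcons k).1 ((hdcons k).2.trans (hα k).symm) hk
  refine ⟨?_, key c hc hcons⟩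
  ext i j
  obtain ⟨k, hk⟩ := hcover i j
  rw [key c hc hcons i j k hk, key c' hc' hcons' i j k hk]
end
end

section
/- Let c ∈ ℝ^{N×M}, (μ,ν) ∈ Δ_N × Δ_M, α = OT_c(μ,ν), and let F be a face of Π(μ,ν) with F ⊆ OPT_c(μ,ν). Let G_1,…,G_R be the sets of extreme points of the proper faces of Π(μ,ν) of maximal dimension among those containing F, and set G = (∪_{r=1}^R G_r) \ F if R ≥ 2, while G = {w} for an arbitrary w ∈ EP(μ,ν) \ F if R = 1. Then for every c' ∈ ℝ^{N×M}: OT_{c'}(μ,ν) = α and F ⊆ OPT_{c'}(μ,ν) if and only if ⟨c',u⟩ = α for all u ∈ F and ⟨c',v⟩ ≥ α for all v ∈ G. -/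
open Finset

noncomputable section

/-- The set `OPT_c(μ,ν)` of optimal transport plans. -/
def OPT {N M : ℕ} (c : Matrix (Fin N) (Fin M) ℝ) (μ : Fin N → ℝ) (ν : Fin M → ℝ) :
    Set (Matrix (Fin N) (Fin M) ℝ) :=
  {π ∈ Plans μ ν | frob c π = OTcost c μ ν}

/-- The set `EP(μ,ν)` of extreme points of the transport polytope. -/
def EP {N M : ℕ} (μ : Fin N → ℝ) (ν : Fin M → ℝ) : Set (Matrix (Fin N) (Fin M) ℝ) :=
  Set.extremePoints ℝ (Plans μ ν)

/-- A face of the transport polytope `Π(μ,ν)`: the set of minimizers of some cost matrix. -/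
def IsFaceOf {N M : ℕ} (μ : Fin N → ℝ) (ν : Fin M → ℝ)
    (F : Set (Matrix (Fin N) (Fin M) ℝ)) : Prop :=
  ∃ d : Matrix (Fin N) (Fin M) ℝ, F = OPT d μ ν

/-- The dimension of a face: the dimension of (the direction of) its affine hull. -/
def faceDim {N M : ℕ} (F : Set (Matrix (Fin N) (Fin M) ℝ)) : ℕ :=
  Module.finrank ℝ (vectorSpan ℝ F)

/-- The proper faces of `Π(μ,ν)` containing `F` that have maximal dimension among those. -/
def MaxFacesCont {N M : ℕ} (μ : Fin N → ℝ) (ν : Fin M → ℝ)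
    (F : Set (Matrix (Fin N) (Fin M) ℝ)) : Set (Set (Matrix (Fin N) (Fin M) ℝ)) :=
  {F' | IsFaceOf μ ν F' ∧ F' ≠ Plans μ ν ∧ F ⊆ F' ∧
    ∀ F'', IsFaceOf μ ν F'' → F'' ≠ Plans μ ν → F ⊆ F'' → faceDim F'' ≤ faceDim F'}

theorem vectorSpan_le_ker_of_const {E : Type*} [AddCommGroup E] [Module ℝ E] {s : Set E}
    (f : E →ₗ[ℝ] ℝ) (a : ℝ) (h : ∀ x ∈ s, f x = a) : vectorSpan ℝ s ≤ LinearMap.ker f := by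
  rw [vectorSpan_def, Submodule.span_le]
  rintro _ ⟨x, hx, y, hy, rfl⟩
  simp [h x hx, h y hy]

/-- The Frobenius pairing with a fixed cost matrix, as a linear functional. -/
def frobLin {N M : ℕ} (c : Matrix (Fin N) (Fin M) ℝ) : Matrix (Fin N) (Fin M) ℝ →ₗ[ℝ] ℝ where
  toFun := frob c
  map_add' x y := by simp [frob, mul_add, Finset.sum_add_distrib]
  map_smul' a x := by
    simp only [frob, Finset.mul_sum, Matrix.smul_apply, smul_eq_mul, RingHom.id_apply]
    exact Finset.sum_congr rfl fun i _ => Finset.sum_congr rfl fun j _ => by ring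

theorem frobLin_apply {N M : ℕ} (c x : Matrix (Fin N) (Fin M) ℝ) : frobLin c x = frob c x := rfl

theorem frob_single {N M : ℕ} (i : Fin N) (j : Fin M) (x : Matrix (Fin N) (Fin M) ℝ) :
    frob (Matrix.single i j 1) x = x i j := by
  simp only [frob, Matrix.single_apply, ite_mul, one_mul, zero_mul]
  rw [Finset.sum_eq_single i, Finset.sum_eq_single j] <;> simp +contextual [eq_comm]

theorem le_of_forall_extremePoints_le {E : Type*} [AddCommGroup E] [Module ℝ E]
    [TopologicalSpace E] [T2Space E] [IsTopologicalAddGroup E] [ContinuousSMul ℝ E]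
    [LocallyConvexSpace ℝ E] {s : Set E} (hs : IsCompact s) (hc : Convex ℝ s)
    (f : E →ₗ[ℝ] ℝ) (hf : Continuous f) (a : ℝ) (h : ∀ x ∈ s.extremePoints ℝ, a ≤ f x) :
    ∀ x ∈ s, a ≤ f x := by
  intro x hx
  rw [← closure_convexHull_extremePoints hs hc] at hx
  have hcl : IsClosed {y | a ≤ f y} := isClosed_le continuous_const hf
  exact closure_minimal (convexHull_min h (convex_halfSpace_ge f.isLinear a)) hcl hx

section Transport

variable {N M : ℕ} {μ : Fin N → ℝ} {ν : Fin M → ℝ}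

theorem continuous_frob (c : Matrix (Fin N) (Fin M) ℝ) : Continuous (frob c) := by
  unfold frob
  fun_prop

theorem convex_plans : Convex ℝ (Plans μ ν) := by
  intro x hx y hy a b ha hb hab
  refine ⟨fun i j => ?_, fun i => ?_, fun j => ?_⟩
  · have := hx.1 i j
    have := hy.1 i j
    simp only [Matrix.add_apply, Matrix.smul_apply, smul_eq_mul]
    positivity
  · simp only [Matrix.add_apply, Matrix.smul_apply, smul_eq_mul, Finset.sum_add_distrib,
      ← Finset.mul_sum, hx.2.1 i, hy.2.1 i, ← add_mul, hab, one_mul]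
  · simp only [Matrix.add_apply, Matrix.smul_apply, smul_eq_mul, Finset.sum_add_distrib,
      ← Finset.mul_sum, hx.2.2 j, hy.2.2 j, ← add_mul, hab, one_mul]

theorem isClosed_plans : IsClosed (Plans μ ν) := by
  simp only [Plans, Set.ofPred_and, Set.ofPred_forall]
  refine IsClosed.inter ?_ (IsClosed.inter ?_ ?_)
  · exact isClosed_iInter fun i => isClosed_iInter fun j =>
      isClosed_le continuous_const (by fun_prop)
  · exact isClosed_iInter fun i => isClosed_eq (by fun_prop) continuous_const
  · exact isClosed_iInter fun j => isClosed_eq (by fun_prop) continuous_const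

theorem isCompact_plans : IsCompact (Plans μ ν) := by
  have hbox : IsCompact (Set.univ.pi fun i : Fin N =>
      Set.univ.pi fun _ : Fin M => Set.Icc (0 : ℝ) (μ i)) :=
    isCompact_univ_pi fun i => isCompact_univ_pi fun _ => isCompact_Icc
  refine hbox.of_isClosed_subset isClosed_plans fun x hx i _ j _ => ⟨hx.1 i j, ?_⟩
  rw [← hx.2.1 i]
  exact Finset.single_le_sum (f := fun j => x i j) (fun j _ => hx.1 i j) (Finset.mem_univ j)

theorem plans_nonempty (hμ : μ ∈ stdSimplex ℝ (Fin N)) (hν : ν ∈ stdSimplex ℝ (Fin M)) :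
    (Plans μ ν).Nonempty := by
  refine ⟨fun i j => μ i * ν j, fun i j => mul_nonneg (hμ.1 i) (hν.1 j), fun i => ?_, fun j => ?_⟩
  · rw [← Finset.mul_sum, hν.2, mul_one]
  · rw [← Finset.sum_mul, hμ.2, one_mul]

theorem OTcost_le (c : Matrix (Fin N) (Fin M) ℝ) {x : Matrix (Fin N) (Fin M) ℝ}
    (hx : x ∈ Plans μ ν) : OTcost c μ ν ≤ frob c x :=
  csInf_le (isCompact_plans.image (continuous_frob c)).bddBelow ⟨x, hx, rfl⟩

theorem OTcost_eq_of_isMin (c : Matrix (Fin N) (Fin M) ℝ) {x : Matrix (Fin N) (Fin M) ℝ}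
    (hx : x ∈ Plans μ ν) (h : ∀ y ∈ Plans μ ν, frob c x ≤ frob c y) :
    OTcost c μ ν = frob c x := by
  refine le_antisymm (OTcost_le c hx) (le_csInf ⟨_, x, hx, rfl⟩ ?_)
  rintro _ ⟨y, hy, rfl⟩
  exact h y hy

theorem OPT_nonempty (c : Matrix (Fin N) (Fin M) ℝ) (h : (Plans μ ν).Nonempty) :
    (OPT c μ ν).Nonempty := by
  obtain ⟨x, hx, hmin⟩ := isCompact_plans.exists_isMinOn h (continuous_frob c).continuousOn
  exact ⟨x, hx, (OTcost_eq_of_isMin c hx fun y hy => hmin hy).symm⟩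

theorem convex_OPT (c : Matrix (Fin N) (Fin M) ℝ) : Convex ℝ (OPT c μ ν) :=
  convex_plans.inter (convex_hyperplane (frobLin c).isLinear _)

theorem isCompact_OPT (c : Matrix (Fin N) (Fin M) ℝ) : IsCompact (OPT c μ ν) :=
  isCompact_plans.inter_right (isClosed_eq (continuous_frob c) continuous_const)

theorem vectorSpan_OPT_le_ker (c : Matrix (Fin N) (Fin M) ℝ) :
    vectorSpan ℝ (OPT c μ ν) ≤ LinearMap.ker (frobLin c) :=
  vectorSpan_le_ker_of_const _ _ fun _ hx => hx.2

/-- A plan that differs from a point of a face by a direction of the face lies in the face. -/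
theorem IsFaceOf.mem_of_sub_mem {F : Set (Matrix (Fin N) (Fin M) ℝ)} (hF : IsFaceOf μ ν F)
    {q y : Matrix (Fin N) (Fin M) ℝ} (hq : q ∈ F) (hy : y ∈ Plans μ ν)
    (h : y - q ∈ vectorSpan ℝ F) : y ∈ F := by
  obtain ⟨c, rfl⟩ := hF
  have h0 := vectorSpan_OPT_le_ker c h
  rw [LinearMap.mem_ker, map_sub, sub_eq_zero, frobLin_apply, frobLin_apply] at h0
  exact ⟨hy, h0.trans hq.2⟩

theorem IsFaceOf.subset_plans {F : Set (Matrix (Fin N) (Fin M) ℝ)} (hF : IsFaceOf μ ν F) :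
    F ⊆ Plans μ ν := by
  obtain ⟨c, rfl⟩ := hF
  exact fun x hx => hx.1

theorem IsFaceOf.exists_notMem {F : Set (Matrix (Fin N) (Fin M) ℝ)} (hF : IsFaceOf μ ν F)
    (hne : F ≠ Plans μ ν) : ∃ x ∈ Plans μ ν, x ∉ F := by
  by_contra! h
  exact hne (hF.subset_plans.antisymm h)

theorem isFaceOf_entry_eq_zero {q : Matrix (Fin N) (Fin M) ℝ} (hq : q ∈ Plans μ ν)
    {i : Fin N} {j : Fin M} (hij : q i j = 0) :
    IsFaceOf μ ν {x ∈ Plans μ ν | x i j = 0} := by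
  refine ⟨Matrix.single i j 1, ?_⟩
  have h : OTcost (Matrix.single i j 1) μ ν = 0 := by
    rw [OTcost_eq_of_isMin _ hq, frob_single, hij]
    intro y hy
    rw [frob_single, frob_single, hij]
    exact hy.1 i j
  simp only [OPT, h, frob_single]

/-- Every face contains a plan whose support is the largest among plans of that face. -/
theorem exists_maximal_support {F : Set (Matrix (Fin N) (Fin M) ℝ)} (hN : 1 ≤ N) (hM : 1 ≤ M)
    (hF : IsFaceOf μ ν F) (hne : F.Nonempty) :
    ∃ q ∈ F, ∀ i j, q i j = 0 → ∀ x ∈ F, x i j = 0 := by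
  have hconv : Convex ℝ F := by
    obtain ⟨c, rfl⟩ := hF
    exact convex_OPT c
  have hw : ∀ k : Fin N × Fin M, ∃ w ∈ F, w k.1 k.2 = 0 → ∀ x ∈ F, x k.1 k.2 = 0 := by
    intro k
    by_cases h : ∃ w ∈ F, w k.1 k.2 ≠ 0
    · obtain ⟨w, hwF, hw⟩ := h
      exact ⟨w, hwF, fun h0 => absurd h0 hw⟩
    · push Not at h
      exact ⟨hne.some, hne.some_mem, fun _ => h⟩
  choose w hwF hw using hw
  have hcard : (0 : ℝ) < Fintype.card (Fin N × Fin M) := by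
    simp only [Fintype.card_prod, Fintype.card_fin]
    exact_mod_cast Nat.mul_pos hN hM
  refine ⟨∑ k, (Fintype.card (Fin N × Fin M) : ℝ)⁻¹ • w k,
    hconv.sum_mem (fun _ _ => by positivity) ?_ fun k _ => hwF k, fun i j h => ?_⟩
  · rw [Finset.sum_const, Finset.card_univ, nsmul_eq_mul, mul_inv_cancel₀ hcard.ne']
  · rw [Matrix.sum_apply, Finset.sum_eq_zero_iff_of_nonneg] at h
    · have := h (i, j) (Finset.mem_univ _)
      rw [Matrix.smul_apply, smul_eq_mul, mul_eq_zero] at this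
      exact hw (i, j) (this.resolve_left (by positivity))
    · intro k _
      exact mul_nonneg (by positivity) ((hF.subset_plans (hwF k)).1 i j)

theorem add_mem_plans {q v : Matrix (Fin N) (Fin M) ℝ} (hq : q ∈ Plans μ ν)
    (hv : v ∈ vectorSpan ℝ (Plans μ ν)) (h : ∀ i j, 0 ≤ q i j + v i j) : q + v ∈ Plans μ ν := by
  refine ⟨h, fun i => ?_, fun j => ?_⟩
  · have h0 := vectorSpan_le_ker_of_const (s := Plans μ ν)
      (∑ j, Matrix.entryLinearMap ℝ ℝ i j) (μ i) (fun x hx => by simpa using hx.2.1 i) hv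
    simp only [LinearMap.mem_ker, LinearMap.sum_apply, Matrix.entryLinearMap_apply] at h0
    simp [Finset.sum_add_distrib, h0, hq.2.1 i]
  · have h0 := vectorSpan_le_ker_of_const (s := Plans μ ν)
      (∑ i, Matrix.entryLinearMap ℝ ℝ i j) (ν j) (fun x hx => by simpa using hx.2.2 j) hv
    simp only [LinearMap.mem_ker, LinearMap.sum_apply, Matrix.entryLinearMap_apply] at h0
    simp [Finset.sum_add_distrib, h0, hq.2.2 j]

/-- A direction that is nonnegative wherever the plan `q` vanishes is feasible at `q`. -/
theorem exists_feasible_step {q v : Matrix (Fin N) (Fin M) ℝ} (hq : q ∈ Plans μ ν)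
    (hv : v ∈ vectorSpan ℝ (Plans μ ν)) (h : ∀ i j, q i j = 0 → 0 ≤ v i j) :
    ∃ ε : ℝ, 0 < ε ∧ q + ε • v ∈ Plans μ ν := by
  have hev : ∀ᶠ ε in nhdsWithin (0 : ℝ) (Set.Ioi 0), ∀ i j, 0 ≤ q i j + ε * v i j := by
    rw [Filter.eventually_all]
    intro i
    rw [Filter.eventually_all]
    intro j
    rcases (hq.1 i j).eq_or_lt' with h0 | h0
    · filter_upwards [self_mem_nhdsWithin] with ε hε
      rw [h0, zero_add]
      exact mul_nonneg (le_of_lt hε) (h i j h0)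
    · have hcont : Continuous fun ε : ℝ => q i j + ε * v i j := by fun_prop
      have hlim := (hcont.tendsto 0).eventually (lt_mem_nhds (a := 0) (by simpa using h0))
      filter_upwards [nhdsWithin_le_nhds hlim] with ε hε using hε.le
  obtain ⟨ε, hnn, hε⟩ := (hev.and self_mem_nhdsWithin).exists
  exact ⟨ε, hε, add_mem_plans hq (Submodule.smul_mem _ _ hv) hnn⟩

/-- A direction of the polytope vanishing wherever a point `q` of a face vanishes is a direction
of the face. -/
theorem mem_vectorSpan_of_vanish {F : Set (Matrix (Fin N) (Fin M) ℝ)} (hF : IsFaceOf μ ν F)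
    {q d : Matrix (Fin N) (Fin M) ℝ} (hq : q ∈ F) (hd : d ∈ vectorSpan ℝ (Plans μ ν))
    (h : ∀ i j, q i j = 0 → d i j = 0) : d ∈ vectorSpan ℝ F := by
  have hqP := hF.subset_plans hq
  obtain ⟨ε, hε, hp⟩ := exists_feasible_step hqP hd fun i j hij => (h i j hij).ge
  obtain ⟨δ, hδ, hm⟩ := exists_feasible_step hqP (Submodule.neg_mem _ hd) fun i j hij => by
    simp [h i j hij]
  have hpF : q + ε • d ∈ F := by
    obtain ⟨c, rfl⟩ := hF
    refine ⟨hp, le_antisymm ?_ (OTcost_le c hp)⟩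
    have h2 := OTcost_le c hm
    rw [← hq.2, ← frobLin_apply, ← frobLin_apply] at h2 ⊢
    simp only [map_add, map_smul, map_neg, smul_eq_mul] at h2 ⊢
    have : frobLin c d ≤ 0 := by
      by_contra! hpos
      have := mul_pos hδ hpos
      linarith
    nlinarith [mul_nonneg hε.le (neg_nonneg.2 this)]
  have hmem := vsub_mem_vectorSpan ℝ hpF hq
  rw [vsub_eq_sub, add_sub_cancel_left] at hmem
  exact (Submodule.smul_mem_iff _ hε.ne').1 hmem

/-- Moving along a direction of the polytope which is not a direction of the face `F`, one leaves
the feasible cone of the polytope at `F` through a proper face containing `F`. -/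
theorem exists_exit_face {F : Set (Matrix (Fin N) (Fin M) ℝ)} (hF : IsFaceOf μ ν F)
    {q x d : Matrix (Fin N) (Fin M) ℝ} (hq : q ∈ F)
    (hsupp : ∀ i j, q i j = 0 → ∀ x ∈ F, x i j = 0) (hx : x ∈ Plans μ ν)
    (hd : d ∈ vectorSpan ℝ (Plans μ ν)) (hdF : d ∉ vectorSpan ℝ F) :
    ∃ t ε : ℝ, 0 < ε ∧ ∃ Q, IsFaceOf μ ν Q ∧ Q ≠ Plans μ ν ∧ F ⊆ Q ∧
      q + ε • (x - q + t • d) ∈ Q := by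
  have hqP := hF.subset_plans hq
  wlog hneg : ∃ i j, q i j = 0 ∧ d i j < 0 generalizing d
  · have hne : ∃ i j, q i j = 0 ∧ d i j ≠ 0 := by
      by_contra! h
      exact hdF (mem_vectorSpan_of_vanish hF hq hd h)
    obtain ⟨i, j, h0, hij⟩ := hne
    have hpos : 0 < d i j := hij.lt_or_gt.resolve_left fun hlt => hneg ⟨i, j, h0, hlt⟩
    obtain ⟨t, ε, hε, Q, hQ⟩ := this (Submodule.neg_mem _ hd)
      (fun h => hdF (by simpa using Submodule.neg_mem _ h)) ⟨i, j, h0, by simpa using hpos⟩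
    refine ⟨-t, ε, hε, Q, ?_⟩
    simpa using hQ
  classical
  obtain ⟨i₀, j₀, hij₀⟩ := hneg
  obtain ⟨⟨i, j⟩, hk, hmin⟩ := Finset.exists_min_image
    (Finset.univ.filter fun k : Fin N × Fin M => q k.1 k.2 = 0 ∧ d k.1 k.2 < 0)
    (fun k => x k.1 k.2 / -d k.1 k.2) ⟨(i₀, j₀), by simpa using hij₀⟩
  simp only [Finset.mem_filter, Finset.mem_univ, true_and, Prod.forall] at hk hmin
  obtain ⟨hq0, hdneg⟩ := hk
  set t := x i j / -d i j with ht
  have ht0 : 0 ≤ t := div_nonneg (hx.1 i j) (by linarith)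
  have hdir : x - q + t • d ∈ vectorSpan ℝ (Plans μ ν) :=
    Submodule.add_mem _ (vsub_mem_vectorSpan ℝ hx hqP) (Submodule.smul_mem _ _ hd)
  obtain ⟨ε, hε, hy⟩ := exists_feasible_step hqP hdir fun a b hab => by
    simp only [Matrix.add_apply, Matrix.sub_apply, Matrix.smul_apply, smul_eq_mul, hab, sub_zero]
    rcases lt_or_ge (d a b) 0 with hlt | hge
    · have := hmin a b ⟨hab, hlt⟩
      rw [le_div_iff₀ (by linarith)] at this
      linarith
    · have := hx.1 a b
      positivity
  refine ⟨t, ε, hε, _, isFaceOf_entry_eq_zero hqP hq0, fun heq => ?_,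
    fun u hu => ⟨hF.subset_plans hu, hsupp i j hq0 u hu⟩, hy, ?_⟩
  · have h0 := vectorSpan_le_ker_of_const (Matrix.entryLinearMap ℝ ℝ i j) 0
      (fun z (hz : z ∈ Plans μ ν) => (heq.ge hz).2) hd
    exact hdneg.ne h0
  · have hne : d i j ≠ 0 := hdneg.ne
    simp only [Matrix.add_apply, Matrix.sub_apply, Matrix.smul_apply, smul_eq_mul, hq0, ht]
    field_simp
    ring

theorem faceDim_lt {F Q : Set (Matrix (Fin N) (Fin M) ℝ)} (hFQ : F ⊆ Q)
    {v : Matrix (Fin N) (Fin M) ℝ} (hv : v ∈ vectorSpan ℝ Q) (hvF : v ∉ vectorSpan ℝ F) :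
    faceDim F < faceDim Q := by
  refine Submodule.finrank_lt_finrank_of_lt (lt_of_le_of_ne (vectorSpan_mono ℝ hFQ) ?_)
  rintro h
  exact hvF (h ▸ hv)

/-- A proper face of maximal dimension has codimension one. -/
theorem vectorSpan_le_sup_of_maximal {F : Set (Matrix (Fin N) (Fin M) ℝ)} (hN : 1 ≤ N)
    (hM : 1 ≤ M) (hF : IsFaceOf μ ν F)
    (hmax : ∀ Q, IsFaceOf μ ν Q → Q ≠ Plans μ ν → F ⊆ Q → faceDim Q ≤ faceDim F)
    {p x : Matrix (Fin N) (Fin M) ℝ} (hp : p ∈ F) (hx : x ∈ Plans μ ν) (hxF : x ∉ F) :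
    vectorSpan ℝ (Plans μ ν) ≤ vectorSpan ℝ F ⊔ Submodule.span ℝ {x - p} := by
  obtain ⟨q, hq, hsupp⟩ := exists_maximal_support hN hM hF ⟨p, hp⟩
  intro d hd
  by_contra hnot
  have hdF : d ∉ vectorSpan ℝ F := fun h => hnot (Submodule.mem_sup_left h)
  obtain ⟨t, ε, hε, Q, hQ, hQP, hFQ, hy⟩ := exists_exit_face hF hq hsupp hx hd hdF
  have hv : x - q + t • d ∈ vectorSpan ℝ Q := by
    have := vsub_mem_vectorSpan ℝ hy (hFQ hq)
    rw [vsub_eq_sub, add_sub_cancel_left] at this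
    exact (Submodule.smul_mem_iff _ hε.ne').1 this
  refine (hmax Q hQ hQP hFQ).not_gt (faceDim_lt hFQ hv fun hvF => ?_)
  have hpq : p - q ∈ vectorSpan ℝ F := vsub_mem_vectorSpan ℝ hp hq
  rcases eq_or_ne t 0 with rfl | ht
  · rw [zero_smul, add_zero] at hvF
    exact hxF (hF.mem_of_sub_mem hq hx hvF)
  · refine hnot ((Submodule.smul_mem_iff _ ht).1 ?_)
    have hdec : t • d = (x - q + t • d - (p - q)) - (x - p) := by abel
    rw [hdec]
    exact Submodule.sub_mem _ (Submodule.mem_sup_left (Submodule.sub_mem _ hvF hpq))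
      (Submodule.mem_sup_right (Submodule.mem_span_singleton_self _))

/-- Every proper face containing `F` lies in one of maximal dimension. -/
theorem exists_maxFacesCont_superset {F Q : Set (Matrix (Fin N) (Fin M) ℝ)} (hN : 1 ≤ N)
    (hM : 1 ≤ M) (hne : F.Nonempty) (hQ : IsFaceOf μ ν Q) (hQP : Q ≠ Plans μ ν) (hFQ : F ⊆ Q) :
    ∃ Q' ∈ MaxFacesCont μ ν F, Q ⊆ Q' := by
  obtain ⟨p, hp⟩ := hne
  let D : Set ℕ := faceDim '' {Q' | IsFaceOf μ ν Q' ∧ Q' ≠ Plans μ ν ∧ Q ⊆ Q'}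
  have hDne : D.Nonempty := ⟨_, Q, ⟨hQ, hQP, subset_rfl⟩, rfl⟩
  have hDbdd : BddAbove D := by
    refine ⟨Module.finrank ℝ (Matrix (Fin N) (Fin M) ℝ), ?_⟩
    rintro _ ⟨Q', -, rfl⟩
    exact Submodule.finrank_le _
  obtain ⟨Q', ⟨hQ', hQ'P, hQQ'⟩, hdim⟩ := Nat.sSup_mem hDne hDbdd
  have hmax : ∀ Q'', IsFaceOf μ ν Q'' → Q'' ≠ Plans μ ν → Q' ⊆ Q'' → faceDim Q'' ≤ faceDim Q' :=
    fun Q'' h1 h2 h3 => hdim ▸ le_csSup hDbdd ⟨Q'', ⟨h1, h2, hQQ'.trans h3⟩, rfl⟩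
  refine ⟨Q', ⟨hQ', hQ'P, hFQ.trans hQQ', fun Q'' h1 h2 h3 => ?_⟩, hQQ'⟩
  obtain ⟨x, hx, hxQ'⟩ := hQ'.exists_notMem hQ'P
  have hle := Submodule.finrank_mono
    (vectorSpan_le_sup_of_maximal hN hM hQ' hmax (hQQ' (hFQ hp)) hx hxQ')
  have hsup := Submodule.finrank_add_le_finrank_add_finrank
    (vectorSpan ℝ Q') (Submodule.span ℝ {x - p})
  have hone : Module.finrank ℝ (Submodule.span ℝ {x - p}) ≤ 1 := by
    simpa using finrank_span_le_card (R := ℝ) ({x - p} : Set (Matrix (Fin N) (Fin M) ℝ))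
  obtain ⟨z, hz, hzQ''⟩ := h1.exists_notMem h2
  have hlt : faceDim Q'' < faceDim (Plans μ ν) :=
    faceDim_lt h1.subset_plans (vsub_mem_vectorSpan ℝ hz (h1.subset_plans (h3 hp)))
      fun h => hzQ'' (h1.mem_of_sub_mem (h3 hp) hz h)
  unfold faceDim at hlt ⊢
  omega

/-- If a single proper face of maximal dimension contains `F`, then it is `F`. -/
theorem eq_of_unique_maxFace {F Q : Set (Matrix (Fin N) (Fin M) ℝ)} (hN : 1 ≤ N) (hM : 1 ≤ M)
    (hne : F.Nonempty) (hF : IsFaceOf μ ν F) (hQ : Q ∈ MaxFacesCont μ ν F)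
    (huniq : ∀ Q' ∈ MaxFacesCont μ ν F, Q' = Q) : Q = F := by
  obtain ⟨q, hq, hsupp⟩ := exists_maximal_support hN hM hF hne
  obtain ⟨hQf, hQP, hFQ, -⟩ := hQ
  refine Set.Subset.antisymm (fun y hy => ?_) hFQ
  by_contra hyF
  obtain ⟨x, hx, hxQ⟩ := hQf.exists_notMem hQP
  have hyP := hQf.subset_plans hy
  obtain ⟨t, ε, hε, Q', hQ', hQ'P, hFQ', hz⟩ := exists_exit_face hF hq hsupp hx
    (vsub_mem_vectorSpan ℝ hyP (hF.subset_plans hq))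
    fun h => hyF (hF.mem_of_sub_mem hq hyP h)
  obtain ⟨Q'', hQ'', hsub⟩ := exists_maxFacesCont_superset hN hM hne hQ' hQ'P hFQ'
  have hzQ := hsub hz
  rw [huniq Q'' hQ''] at hzQ
  have hv := vsub_mem_vectorSpan ℝ hzQ (hFQ hq)
  rw [vsub_eq_sub, add_sub_cancel_left, Submodule.smul_mem_iff _ hε.ne'] at hv
  have hyq : y -ᵥ q ∈ vectorSpan ℝ Q := vsub_mem_vectorSpan ℝ hy (hFQ hq)
  exact hxQ (hQf.mem_of_sub_mem (hFQ hq) hx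
    ((Submodule.add_mem_iff_left _ (Submodule.smul_mem _ t hyq)).1 hv))

/-- For a face of codimension one, a single plan off the face decides nonnegativity. -/
theorem le_frob_of_codim_one {F : Set (Matrix (Fin N) (Fin M) ℝ)} (hF : IsFaceOf μ ν F)
    {q w : Matrix (Fin N) (Fin M) ℝ} (hq : q ∈ F) (hw : w ∈ Plans μ ν) (hwF : w ∉ F)
    (hspan : vectorSpan ℝ (Plans μ ν) ≤ vectorSpan ℝ F ⊔ Submodule.span ℝ {w - q})
    {c' : Matrix (Fin N) (Fin M) ℝ} {α : ℝ} (hc : ∀ u ∈ F, frob c' u = α)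
    (hcw : α ≤ frob c' w) {x : Matrix (Fin N) (Fin M) ℝ} (hx : x ∈ Plans μ ν) :
    α ≤ frob c' x := by
  obtain ⟨f, hf, g, hg, hfg⟩ := Submodule.mem_sup.1
    (hspan (vsub_mem_vectorSpan ℝ hx (hF.subset_plans hq)))
  obtain ⟨s, rfl⟩ := Submodule.mem_span_singleton.1 hg
  have hcf : frobLin c' f = 0 := vectorSpan_le_ker_of_const (frobLin c') α hc hf
  have hcx := congrArg (frobLin c') hfg
  obtain ⟨b, rfl⟩ := hF
  have hbf : frobLin b f = 0 := vectorSpan_OPT_le_ker b hf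
  have hbx := congrArg (frobLin b) hfg
  simp only [vsub_eq_sub, map_add, map_smul, map_sub, smul_eq_mul, hcf, hbf, zero_add,
    frobLin_apply] at hcx hbx
  rw [hc q hq] at hcx
  have h1 : frob b q ≤ frob b x := hq.2.trans_le (OTcost_le b hx)
  have h2 : frob b q < frob b w :=
    lt_of_le_of_ne (hq.2.trans_le (OTcost_le b hw)) fun h => hwF ⟨hw, h.symm.trans hq.2⟩
  have hs : 0 ≤ s := nonneg_of_mul_nonneg_left (by linarith) (sub_pos.2 h2)
  nlinarith [mul_nonneg hs (sub_nonneg.2 hcw)]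

/-- If several proper faces of maximal dimension contain `F`, a cost that is constant on `F` and
no smaller on those faces is no smaller on the whole polytope. -/
theorem le_frob_of_maxFaces {F Q : Set (Matrix (Fin N) (Fin M) ℝ)} (hN : 1 ≤ N) (hM : 1 ≤ M)
    (hne : F.Nonempty) (hF : IsFaceOf μ ν F) (hQ : IsFaceOf μ ν Q) (hQP : Q ≠ Plans μ ν)
    (hFQ : F ⊆ Q) (hQF : Q ≠ F) {c' : Matrix (Fin N) (Fin M) ℝ} {α : ℝ}
    (hc : ∀ u ∈ F, frob c' u = α)
    (hmax : ∀ Q' ∈ MaxFacesCont μ ν F, ∀ y ∈ Q', α ≤ frob c' y)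
    {x : Matrix (Fin N) (Fin M) ℝ} (hx : x ∈ Plans μ ν) : α ≤ frob c' x := by
  by_contra! hlt
  obtain ⟨q, hq, hsupp⟩ := exists_maximal_support hN hM hF hne
  have hqP := hF.subset_plans hq
  have hxq : frobLin c' (x - q) < 0 := by
    rw [map_sub, frobLin_apply, frobLin_apply, hc q hq]
    linarith
  by_cases hd : ∃ d ∈ vectorSpan ℝ (Plans μ ν), frobLin c' d = 0 ∧ d ∉ vectorSpan ℝ F
  · obtain ⟨d, hdV, hd0, hdF⟩ := hd
    obtain ⟨t, ε, hε, Q', hQ', hQ'P, hFQ', hy⟩ := exists_exit_face hF hq hsupp hx hdV hdF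
    obtain ⟨Q'', hQ'', hsub⟩ := exists_maxFacesCont_superset hN hM hne hQ' hQ'P hFQ'
    have h := hmax Q'' hQ'' _ (hsub hy)
    rw [← frobLin_apply, map_add, map_smul, map_add, map_smul, hd0, frobLin_apply, hc q hq] at h
    simp only [smul_eq_mul, mul_zero, add_zero] at h
    nlinarith [mul_neg_of_pos_of_neg hε hxq]
  · push Not at hd
    have hdec : ∀ v ∈ vectorSpan ℝ (Plans μ ν), ∃ s : ℝ, v - s • (x - q) ∈ vectorSpan ℝ F := by
      intro v hv
      refine ⟨frobLin c' v / frobLin c' (x - q), hd _ (Submodule.sub_mem _ hv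
        (Submodule.smul_mem _ _ (vsub_mem_vectorSpan ℝ hx hqP))) ?_⟩
      rw [map_sub, map_smul, smul_eq_mul, div_mul_cancel₀ _ hxq.ne, sub_self]
    obtain ⟨z, hz, hzF⟩ : ∃ z ∈ Q, z ∉ F := by
      by_contra! h
      exact hQF (Set.Subset.antisymm h hFQ)
    have hzP := hQ.subset_plans hz
    obtain ⟨s, hs⟩ := hdec (z - q) (vsub_mem_vectorSpan ℝ hzP hqP)
    rcases eq_or_ne s 0 with rfl | hs0
    · rw [zero_smul, sub_zero] at hs
      exact hzF (hF.mem_of_sub_mem hq hzP hs)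
    · have hxQ : x - q ∈ vectorSpan ℝ Q := by
        rw [← Submodule.smul_mem_iff _ hs0]
        have := Submodule.sub_mem _ (vsub_mem_vectorSpan ℝ hz (hFQ hq)) (vectorSpan_mono ℝ hFQ hs)
        simpa using this
      obtain ⟨y, hy, hyQ⟩ := hQ.exists_notMem hQP
      obtain ⟨r, hr⟩ := hdec (y - q) (vsub_mem_vectorSpan ℝ hy hqP)
      refine hyQ (hQ.mem_of_sub_mem (hFQ hq) hy ?_)
      have := Submodule.add_mem _ (vectorSpan_mono ℝ hFQ hr) (Submodule.smul_mem _ r hxQ)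
      simpa using this

theorem IsFaceOf.le_frob_of_extremePoints {Q : Set (Matrix (Fin N) (Fin M) ℝ)}
    (hQ : IsFaceOf μ ν Q) {c' : Matrix (Fin N) (Fin M) ℝ} {α : ℝ}
    (h : ∀ v ∈ Q.extremePoints ℝ, α ≤ frob c' v) : ∀ y ∈ Q, α ≤ frob c' y := by
  obtain ⟨b, rfl⟩ := hQ
  have : LocallyConvexSpace ℝ (Matrix (Fin N) (Fin M) ℝ) :=
    inferInstanceAs (LocallyConvexSpace ℝ (Fin N → Fin M → ℝ))
  exact le_of_forall_extremePoints_le (isCompact_OPT b) (convex_OPT b)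
    (frobLin c') (continuous_frob c') α h

end Transport

/-- Lemma: the consistency of a cost matrix with an observed optimal face and total cost can be
checked on the face and on the extreme points of the maximal proper faces containing it. -/
theorem stmt13 (N M : ℕ) (hN : 1 ≤ N) (hM : 1 ≤ M)
    (μ : Fin N → ℝ) (ν : Fin M → ℝ)
    (hμ : μ ∈ stdSimplex ℝ (Fin N)) (hν : ν ∈ stdSimplex ℝ (Fin M))
    (c : Matrix (Fin N) (Fin M) ℝ) (α : ℝ) (hα : α = OTcost c μ ν)
    (F : Set (Matrix (Fin N) (Fin M) ℝ))
    (hface : IsFaceOf μ ν F) (hFopt : F ⊆ OPT c μ ν)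
    (R : ℕ) (hR : 1 ≤ R) (Ffam : Fin R → Set (Matrix (Fin N) (Fin M) ℝ))
    (hmem : ∀ r, Ffam r ∈ MaxFacesCont μ ν F)
    (hinj : Function.Injective Ffam)
    (hsurj : ∀ F' ∈ MaxFacesCont μ ν F, ∃ r, Ffam r = F')
    (G : Set (Matrix (Fin N) (Fin M) ℝ))
    (hG2 : 2 ≤ R → G = (⋃ r, Set.extremePoints ℝ (Ffam r)) \ F)
    (hG1 : R = 1 → ∃ w ∈ EP μ ν \ F, G = {w}) :
    ∀ c' : Matrix (Fin N) (Fin M) ℝ,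
      (OTcost c' μ ν = α ∧ F ⊆ OPT c' μ ν) ↔
        ((∀ u ∈ F, frob c' u = α) ∧ ∀ v ∈ G, α ≤ frob c' v) := by
  intro c'
  have hP := plans_nonempty hμ hν
  have hne : F.Nonempty := by
    obtain ⟨b, rfl⟩ := hface
    exact OPT_nonempty b hP
  obtain ⟨q, hq⟩ := hne
  have hr : ∀ r, IsFaceOf μ ν (Ffam r) := fun r => (hmem r).1
  constructor
  · rintro ⟨hOT, hsub⟩
    refine ⟨fun u hu => (hsub hu).2.trans hOT, fun v hv => ?_⟩
    suffices hvP : v ∈ Plans μ ν from hOT ▸ OTcost_le c' hvP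
    rcases hR.eq_or_lt' with h1 | h2
    · obtain ⟨w, hw, rfl⟩ := hG1 h1
      rw [Set.mem_singleton_iff.1 hv]
      exact hw.1.1
    · rw [hG2 h2] at hv
      obtain ⟨r, hvr⟩ := Set.mem_iUnion.1 hv.1
      exact (hr r).subset_plans hvr.1
  · rintro ⟨hc, hcG⟩
    suffices hle : ∀ x ∈ Plans μ ν, α ≤ frob c' x by
      have hOT : OTcost c' μ ν = α := by
        rw [← hc q hq]
        exact OTcost_eq_of_isMin c' (hface.subset_plans hq) fun y hy => hc q hq ▸ hle y hy
      exact ⟨hOT, fun u hu => ⟨hface.subset_plans hu, (hc u hu).trans hOT.symm⟩⟩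
    intro x hx
    rcases hR.eq_or_lt' with h1 | h2
    · obtain ⟨w, ⟨hwE, hwF⟩, rfl⟩ := hG1 h1
      subst h1
      have hF0 : Ffam 0 = F := eq_of_unique_maxFace hN hM ⟨q, hq⟩ hface (hmem 0) fun Q' hQ' => by
        obtain ⟨r, rfl⟩ := hsurj Q' hQ'
        rw [Subsingleton.elim r 0]
      obtain ⟨-, -, -, hmax⟩ := hmem 0
      rw [hF0] at hmax
      exact le_frob_of_codim_one hface hq hwE.1 hwF
        (vectorSpan_le_sup_of_maximal hN hM hface hmax hq hwE.1 hwF) hc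
        (hcG w (Set.mem_singleton w)) hx
    · obtain ⟨r, hrF⟩ : ∃ r, Ffam r ≠ F := by
        by_contra! h
        have := hinj ((h ⟨0, by omega⟩).trans (h ⟨1, by omega⟩).symm)
        simp at this
      obtain ⟨hrf, hrP, hFr, -⟩ := hmem r
      refine le_frob_of_maxFaces hN hM ⟨q, hq⟩ hface hrf hrP hFr hrF hc ?_ hx
      intro Q' hQ'
      obtain ⟨s, rfl⟩ := hsurj Q' hQ'
      refine (hr s).le_frob_of_extremePoints fun v hv => ?_
      by_cases hvF : v ∈ F
      · exact (hc v hvF).ge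
      · exact hcG v (hG2 h2 ▸ ⟨Set.mem_iUnion.2 ⟨s, hv⟩, hvF⟩)
end
end
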